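/- (Diagonal theorem, first part.) Let U be a reflexive Banach space, and let families of functionals (E_n^ℓ)_{ℓ,n ∈ ℕ}, (E_n)_{n ∈ ℕ}, E : U × U → ℝ ∪ {+∞} be given, together with points u_n^ℓ, u_n ∈ U and u ∈ U, and positive reals ε_n^ℓ, ε_n with ε_n^ℓ → 0 as ℓ → ∞ (for each n) and ε_n → 0, such that E_n^ℓ(u_n^ℓ,u_n^ℓ) ≤ inf_v E_n^ℓ(v,u_n^ℓ) + ε_n^ℓ and E_n(u_n,u_n) ≤ inf_v E_n(v,u_n) + ε_n. Assume that for each n, (E_n^ℓ)_ℓ Mosco-converges to E_n and u_n^ℓ ⇀ u_n as ℓ → ∞, and that (E_n)_n Mosco-converges to E and u_n ⇀ u as n → ∞. Then there exists a sequence ℓ_n → ∞ such that lim_{n→∞} inf_v E_n^{ℓ_n}(v, u_n^{ℓ_n}) = inf_v E(v, u). -/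

import Mathlib

open Filter Topology

noncomputable section

/-- Weak convergence of a sequence in a normed space, tested against all
continuous linear functionals. -/
def WeakConv {U : Type*} [NormedAddCommGroup U] [NormedSpace ℝ U]
    (u : ℕ → U) (x : U) : Prop :=
  ∀ f : U →L[ℝ] ℝ, Tendsto (fun n => f (u n)) atTop (𝓝 (f x))

/-- Mosco convergence of a sequence of equilibrium functionals on `U × U`. -/
def MoscoBiv {U : Type*} [NormedAddCommGroup U] [NormedSpace ℝ U]
    (En : ℕ → U → U → EReal) (E : U → U → EReal) : Prop :=
  (∀ (u : ℕ → U) (x : U), WeakConv u x →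
      E x x ≤ liminf (fun n => En n (u n) (u n)) atTop) ∧
  (∀ (u : ℕ → U) (x : U), WeakConv u x →
    ∀ v : U, ∃ w : ℕ → U, Tendsto w atTop (𝓝 v) ∧
      limsup (fun n => En n (w n) (u n)) atTop ≤ E v x)

theorem inf_tendsto_aux {U : Type*} [NormedAddCommGroup U] [NormedSpace ℝ U]
    (F : ℕ → U → U → EReal) (G : U → U → EReal) (x : ℕ → U) (y : U) (ε : ℕ → ℝ)
    (hε : Tendsto ε atTop (𝓝 0))
    (hmin : ∀ l, F l (x l) (x l) ≤ (⨅ v, F l v (x l)) + ((ε l : ℝ) : EReal))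
    (hM : MoscoBiv F G) (hw : WeakConv x y) :
    Tendsto (fun l => ⨅ v, F l v (x l)) atTop (𝓝 (⨅ v, G v y)) := by
  rw [tendsto_order]
  constructor
  · intro c hc
    obtain ⟨r, hcr, hr⟩ := EReal.lt_iff_exists_real_btwn.1 hc
    obtain ⟨s, hrs, hs⟩ := EReal.lt_iff_exists_real_btwn.1 hr
    have hrs' : r < s := by exact_mod_cast hrs
    have h1 : (s : EReal) < liminf (fun n => F n (x n) (x n)) atTop :=
      lt_of_lt_of_le (lt_of_lt_of_le hs (iInf_le _ y)) (hM.1 x y hw)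
    have h2 := eventually_lt_of_lt_liminf h1
    have h3 : ∀ᶠ l in atTop, ε l < s - r := hε.eventually_lt_const (by linarith)
    filter_upwards [h2, h3] with l hl2 hl3
    refine lt_of_lt_of_le hcr (le_of_lt ?_)
    by_contra hcon
    rw [not_lt] at hcon
    have h4 : (⨅ v, F l v (x l)) + ((ε l : ℝ) : EReal) ≤ (r : EReal) + ((s - r : ℝ) : EReal) :=
      add_le_add hcon (by exact_mod_cast hl3.le)
    have h5 : (r : EReal) + ((s - r : ℝ) : EReal) = (s : EReal) := by
      rw [← EReal.coe_add]; congr 1; ring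
    rw [h5] at h4
    exact absurd (lt_of_lt_of_le hl2 ((hmin l).trans h4)) (lt_irrefl _)
  · intro c hc
    obtain ⟨v, hv⟩ := iInf_lt_iff.1 hc
    obtain ⟨w, -, hlim⟩ := hM.2 x y hw v
    have h2 := eventually_lt_of_limsup_lt (lt_of_le_of_lt hlim hv)
    filter_upwards [h2] with l hl
    exact lt_of_le_of_lt (iInf_le _ (w l)) hl

theorem diag_aux (b : ℕ → ℕ → EReal) (c : ℕ → EReal) (a : EReal)
    (hb : ∀ n, Tendsto (b n) atTop (𝓝 (c n))) (hc : Tendsto c atTop (𝓝 a)) :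
    ∃ ln : ℕ → ℕ, Tendsto ln atTop atTop ∧ Tendsto (fun n => b n (ln n)) atTop (𝓝 a) := by
  letI := TopologicalSpace.metrizableSpaceMetric EReal
  have h : ∀ n : ℕ, ∃ l, n ≤ l ∧ dist (b n l) (c n) < 1 / ((n : ℝ) + 1) := fun n =>
    ((eventually_ge_atTop n).and
      (Metric.tendsto_nhds.1 (hb n) _ Nat.one_div_pos_of_nat)).exists
  choose ln h1 h2 using h
  refine ⟨ln, tendsto_atTop_mono h1 tendsto_id, ?_⟩
  rw [tendsto_iff_dist_tendsto_zero] at hc ⊢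
  refine squeeze_zero (fun _ => dist_nonneg)
    (fun n => (dist_triangle _ (c n) _).trans (add_le_add (h2 n).le le_rfl)) ?_
  simpa using tendsto_one_div_add_atTop_nhds_zero_nat.add hc

/-- Diagonal theorem, first part: given a doubly indexed family of
functionals with corresponding almost-equilibria, Mosco convergence in `ℓ` for each
`n` and Mosco convergence of the intermediate family in `n`, there is a diagonal
sequence `ℓ_n → ∞` along which the infima converge to `inf_v E(v,u)`. -/
theorem stmt8 {U : Type*} [NormedAddCommGroup U] [NormedSpace ℝ U] [CompleteSpace U]
    (hrefl : Function.Surjective ⇑(NormedSpace.inclusionInDoubleDual ℝ U))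
    (Enl : ℕ → ℕ → U → U → EReal) (En : ℕ → U → U → EReal) (E : U → U → EReal)
    (hEnlbot : ∀ n l v u, Enl n l v u ≠ ⊥) (hEnbot : ∀ n v u, En n v u ≠ ⊥)
    (hEbot : ∀ v u, E v u ≠ ⊥)
    (unl : ℕ → ℕ → U) (un : ℕ → U) (u : U)
    (εnl : ℕ → ℕ → ℝ) (εn : ℕ → ℝ)
    (hεnlpos : ∀ n l, 0 < εnl n l) (hεnpos : ∀ n, 0 < εn n)
    (hεnl : ∀ n, Tendsto (εnl n) atTop (𝓝 0)) (hεn : Tendsto εn atTop (𝓝 0))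
    (hminnl : ∀ n l,
      Enl n l (unl n l) (unl n l) ≤ (⨅ v, Enl n l v (unl n l)) + ((εnl n l : ℝ) : EReal))
    (hminn : ∀ n,
      En n (un n) (un n) ≤ (⨅ v, En n v (un n)) + ((εn n : ℝ) : EReal))
    (hMoscol : ∀ n, MoscoBiv (fun l => Enl n l) (En n))
    (hwl : ∀ n, WeakConv (fun l => unl n l) (un n))
    (hMoscon : MoscoBiv En E)
    (hw : WeakConv un u) :
    ∃ ln : ℕ → ℕ, Tendsto ln atTop atTop ∧
      Tendsto (fun n => ⨅ v, Enl n (ln n) v (unl n (ln n))) atTop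
        (𝓝 (⨅ v, E v u)) := by
  exact diag_aux _ _ _
    (fun n => inf_tendsto_aux _ _ _ _ _ (hεnl n) (hminnl n) (hMoscol n) (hwl n))
    (inf_tendsto_aux _ _ _ _ _ hεn hminn hMoscon hw)
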